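/- arXiv:math-ph/0506022 — 5 statements merged into one kernel-verified Lean document; each statement's English description precedes it below -/
import Mathlib

section
/- First variation formula for the Lagrangian action (coordinate version): Let L : J → ℝ be smooth, let φ : (Fin m → ℝ) → (Fin n → ℝ) be smooth, and let Z : (Fin m → ℝ) → (Fin n → ℝ) be smooth and compactly supported. Then the function t ↦ ∫ ( L(j¹(φ + t•Z)(x)) − L(j¹φ(x)) ) dx has derivative at t = 0 equal to ∫ Σ_A Z^A(x) · ( (∂L/∂y^A)(j¹φ(x)) − Σ_ν ∂/∂x^ν[ x' ↦ (∂L/∂v^A_ν)(j¹φ(x')) ](x) ) dx. -/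
open MeasureTheory

/-- Partial derivative of a real-valued function on `Fin m → ℝ` in the `ν`-th
coordinate direction. -/
noncomputable def pd {m : ℕ} (f : (Fin m → ℝ) → ℝ) (ν : Fin m) (x : Fin m → ℝ) : ℝ :=
  fderiv ℝ f x (Pi.single ν 1)

/-- First jet prolongation of `φ`. -/
noncomputable def j1 {m n : ℕ} (φ : (Fin m → ℝ) → (Fin n → ℝ)) (x : Fin m → ℝ) :
    (Fin m → ℝ) × (Fin n → ℝ) × (Fin n → Fin m → ℝ) :=
  (x, φ x, fun A ν => pd (fun x' => φ x' A) ν x)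

/-- Partial derivative of the Lagrangian in the `y^A` slot. -/
noncomputable def Ly {m n : ℕ} (L : (Fin m → ℝ) × (Fin n → ℝ) × (Fin n → Fin m → ℝ) → ℝ)
    (z : (Fin m → ℝ) × (Fin n → ℝ) × (Fin n → Fin m → ℝ)) (A : Fin n) : ℝ :=
  fderiv ℝ L z (0, Pi.single A 1, 0)

/-- Partial derivative of the Lagrangian in the `v^A_ν` slot. -/
noncomputable def Lv {m n : ℕ} (L : (Fin m → ℝ) × (Fin n → ℝ) × (Fin n → Fin m → ℝ) → ℝ)
    (z : (Fin m → ℝ) × (Fin n → ℝ) × (Fin n → Fin m → ℝ)) (A : Fin n) (ν : Fin m) : ℝ :=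
  fderiv ℝ L z (0, 0, Pi.single A (Pi.single ν 1))

section FirstVariation

open Set

variable {m n : ℕ}

/-- Differentiation under the integral sign along `t ↦ p x + t • V x` for a compactly supported
direction field `V`. -/
theorem hasDerivAt_integral_comp_add_smul {X E : Type*} [TopologicalSpace X] [MeasurableSpace X]
    [OpensMeasurableSpace X] [T2Space X] {μ : Measure X} [IsFiniteMeasureOnCompacts μ]
    [NormedAddCommGroup E] [NormedSpace ℝ E] {L : E → ℝ} (hL : ContDiff ℝ 1 L)
    {p V : X → E} (hp : Continuous p) (hV : Continuous V) (hVc : HasCompactSupport V) :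
    HasDerivAt (fun t : ℝ => ∫ x, (L (p x + t • V x) - L (p x)) ∂μ)
      (∫ x, fderiv ℝ L (p x) (V x) ∂μ) 0 := by
  have hF' : Continuous fun q : ℝ × X => fderiv ℝ L (p q.2 + q.1 • V q.2) (V q.2) :=
    ((hL.continuous_fderiv one_ne_zero).comp (by fun_prop)).clm_apply (by fun_prop)
  have hV0 : ∀ x, x ∉ tsupport V → V x = 0 := fun x => image_eq_zero_of_notMem_tsupport
  obtain ⟨C, hC⟩ := ((isCompact_Icc (a := (-1 : ℝ)) (b := 1)).prod
    hVc.isCompact).exists_bound_of_continuousOn hF'.continuousOn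
  have hsupp : ∀ t : ℝ,
      HasCompactSupport fun x => L (p x + t • V x) - L (p x) := fun t =>
    HasCompactSupport.intro hVc.isCompact fun x hx => by simp [hV0 x hx]
  have hcont : ∀ t : ℝ, Continuous fun x => L (p x + t • V x) - L (p x) := fun t =>
    (hL.continuous.comp (by fun_prop)).sub (hL.continuous.comp hp)
  have hint : ∀ t : ℝ, Integrable (fun x => L (p x + t • V x) - L (p x)) μ := fun t =>
    (hcont t).integrable_of_hasCompactSupport (hsupp t)
  have hint' : Integrable (fun x => fderiv ℝ L (p x + (0 : ℝ) • V x) (V x)) μ :=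
    (hF'.comp (Continuous.prodMk_right (0 : ℝ))).integrable_of_hasCompactSupport
      (HasCompactSupport.intro hVc.isCompact fun x hx => by simp [hV0 x hx])
  have key := hasDerivAt_integral_of_dominated_loc_of_deriv_le (μ := μ)
    (F := fun (t : ℝ) x => L (p x + t • V x) - L (p x))
    (F' := fun t x => fderiv ℝ L (p x + t • V x) (V x))
    (x₀ := (0 : ℝ)) (s := Icc (-1) 1) (bound := (tsupport V).indicator fun _ => C)
    (Icc_mem_nhds (by norm_num) (by norm_num))
    (Filter.Eventually.of_forall fun t => (hint t).aestronglyMeasurable) (hint 0)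
    hint'.aestronglyMeasurable
    (Filter.Eventually.of_forall fun x t ht => ?_)
    ((integrableOn_const hVc.isCompact.measure_lt_top.ne).integrable_indicator
      hVc.isCompact.measurableSet)
    (Filter.Eventually.of_forall fun x t _ => ?_)
  · simpa using key.2
  · by_cases hx : x ∈ tsupport V
    · simpa [hx] using hC (t, x) ⟨ht, hx⟩
    · simp [hx, hV0 x hx]
  · have h1 : HasDerivAt (fun t : ℝ => p x + t • V x) (V x) t := by
      simpa using ((hasDerivAt_id t).smul_const (V x)).const_add (p x)
    exact (((hL.differentiable one_ne_zero) _).hasFDerivAt.comp_hasDerivAt t h1).sub_const _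

theorem contDiff_pd {f : (Fin m → ℝ) → ℝ} (hf : ContDiff ℝ (⊤ : ℕ∞) f) (ν : Fin m) :
    ContDiff ℝ (⊤ : ℕ∞) (pd f ν) :=
  (hf.fderiv_right (m := (⊤ : ℕ∞)) le_rfl).clm_apply contDiff_const

theorem contDiff_j1 {φ : (Fin m → ℝ) → (Fin n → ℝ)} (hφ : ContDiff ℝ (⊤ : ℕ∞) φ) :
    ContDiff ℝ (⊤ : ℕ∞) (j1 φ) :=
  contDiff_id.prodMk (hφ.prodMk (contDiff_pi.2 fun A => contDiff_pi.2 fun ν =>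
    contDiff_pd (contDiff_pi.1 hφ A) ν))

theorem pd_eq_zero_of_notMem_tsupport {Z : (Fin m → ℝ) → (Fin n → ℝ)} {x : Fin m → ℝ}
    (hx : x ∉ tsupport Z) (A : Fin n) (ν : Fin m) : pd (fun x' => Z x' A) ν x = 0 := by
  have h : (fun x' => Z x' A) =ᶠ[nhds x] fun _ => 0 :=
    (notMem_tsupport_iff_eventuallyEq.1 hx).mono fun y hy => by simp [hy]
  simp [pd, h.fderiv_eq]

/-- The vertical part of the first jet prolongation: the direction in which `j1 φ` moves when `φ`
moves along `Z`. -/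
noncomputable def j1Vertical (Z : (Fin m → ℝ) → (Fin n → ℝ)) (x : Fin m → ℝ) :
    (Fin m → ℝ) × (Fin n → ℝ) × (Fin n → Fin m → ℝ) :=
  (0, Z x, fun A ν => pd (fun x' => Z x' A) ν x)

theorem continuous_j1Vertical {Z : (Fin m → ℝ) → (Fin n → ℝ)} (hZ : ContDiff ℝ (⊤ : ℕ∞) Z) :
    Continuous (j1Vertical Z) :=
  continuous_const.prodMk (contDiff_j1 hZ).continuous.snd

theorem hasCompactSupport_j1Vertical {Z : (Fin m → ℝ) → (Fin n → ℝ)}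
    (hZc : HasCompactSupport Z) : HasCompactSupport (j1Vertical Z) :=
  HasCompactSupport.intro hZc.isCompact fun x hx => by
    ext <;> simp [j1Vertical, image_eq_zero_of_notMem_tsupport hx,
      pd_eq_zero_of_notMem_tsupport hx]

theorem j1_add_smul {φ Z : (Fin m → ℝ) → (Fin n → ℝ)} (hφ : Differentiable ℝ φ)
    (hZ : Differentiable ℝ Z) (t : ℝ) (x : Fin m → ℝ) :
    j1 (φ + t • Z) x = j1 φ x + t • j1Vertical Z x := by
  have h (A : Fin n) (ν : Fin m) : pd (fun x' => (φ + t • Z) x' A) ν x =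
      pd (fun x' => φ x' A) ν x + t * pd (fun x' => Z x' A) ν x := by
    have h1 : HasFDerivAt (fun x' => (φ + t • Z) x' A)
        (fderiv ℝ (fun x' => φ x' A) x + t • fderiv ℝ (fun x' => Z x' A) x) x :=
      ((differentiable_pi.1 hφ A) x).hasFDerivAt.add
        (((differentiable_pi.1 hZ A) x).hasFDerivAt.const_smul t)
    rw [pd, h1.fderiv]
    rfl
  refine Prod.ext ?_ (Prod.ext ?_ ?_)
  · simp [j1, j1Vertical]
  · simp [j1, j1Vertical]
  · ext A ν
    exact h A ν

theorem fderiv_apply_vertical (L : (Fin m → ℝ) × (Fin n → ℝ) × (Fin n → Fin m → ℝ) → ℝ)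
    (z : (Fin m → ℝ) × (Fin n → ℝ) × (Fin n → Fin m → ℝ)) (y : Fin n → ℝ)
    (v : Fin n → Fin m → ℝ) :
    fderiv ℝ L z (0, y, v) =
      ∑ A, (y A * Ly L z A + ∑ ν, Lv L z A ν * v A ν) := by
  have h : ((0, y, v) : (Fin m → ℝ) × (Fin n → ℝ) × (Fin n → Fin m → ℝ)) =
      ∑ A, (y A • (0, Pi.single A 1, 0) + ∑ ν, v A ν • (0, 0, Pi.single A (Pi.single ν 1))) := by
    refine Prod.ext ?_ (Prod.ext ?_ ?_)
    · simp [Prod.fst_sum]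
    · ext B
      simp [Prod.fst_sum, Prod.snd_sum, Finset.sum_apply, Pi.single_apply]
    · ext B μ
      simp [Prod.snd_sum, Finset.sum_apply, Pi.single_apply, ite_apply, Finset.sum_ite_irrel]
  rw [h]
  simp only [map_sum, map_add, map_smul, smul_eq_mul, Ly, Lv, mul_comm]

/-- Integration by parts against a compactly supported function. -/
theorem integral_mul_pd_eq_neg {f g : (Fin m → ℝ) → ℝ} (hf : ContDiff ℝ (⊤ : ℕ∞) f)
    (hg : ContDiff ℝ (⊤ : ℕ∞) g) (hgc : HasCompactSupport g) (ν : Fin m) :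
    ∫ x, f x * pd g ν x = -∫ x, pd f ν x * g x :=
  integral_mul_fderiv_eq_neg_fderiv_mul_of_integrable
    (((contDiff_pd hf ν).continuous.mul hg.continuous).integrable_of_hasCompactSupport
      hgc.mul_left)
    ((hf.continuous.mul (contDiff_pd hg ν).continuous).integrable_of_hasCompactSupport
      (hgc.fderiv_apply ℝ _).mul_left)
    ((hf.continuous.mul hg.continuous).integrable_of_hasCompactSupport hgc.mul_left)
    (fun x _ => hf.differentiable (by simp) x) (fun x _ => hg.differentiable (by simp) x)

end FirstVariation

/-- First variation formula for the Lagrangian action. -/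
theorem first_variation_of_lagrangian_action
    (m n : ℕ) (hm : 0 < m) (hn : 0 < n)
    (L : (Fin m → ℝ) × (Fin n → ℝ) × (Fin n → Fin m → ℝ) → ℝ) (hL : ContDiff ℝ (⊤ : ℕ∞) L)
    (φ : (Fin m → ℝ) → (Fin n → ℝ)) (hφ : ContDiff ℝ (⊤ : ℕ∞) φ)
    (Z : (Fin m → ℝ) → (Fin n → ℝ)) (hZ : ContDiff ℝ (⊤ : ℕ∞) Z) (hZc : HasCompactSupport Z) :
    HasDerivAt
      (fun t : ℝ => ∫ x : Fin m → ℝ, (L (j1 (φ + t • Z) x) - L (j1 φ x)))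
      (∫ x : Fin m → ℝ, ∑ A : Fin n, Z x A *
        (Ly L (j1 φ x) A - ∑ ν : Fin m, pd (fun x' => Lv L (j1 φ x') A ν) ν x))
      0 := by
  have hφd : Differentiable ℝ φ := hφ.differentiable (by simp)
  have hZd : Differentiable ℝ Z := hZ.differentiable (by simp)
  have hj := contDiff_j1 hφ
  have hdL : ContDiff ℝ (⊤ : ℕ∞) fun x => fderiv ℝ L (j1 φ x) :=
    (hL.fderiv_right (m := (⊤ : ℕ∞)) le_rfl).comp hj
  have hLy (A : Fin n) : Continuous fun x => Ly L (j1 φ x) A :=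
    hdL.continuous.clm_apply continuous_const
  have hLv (A : Fin n) (ν : Fin m) : ContDiff ℝ (⊤ : ℕ∞) fun x => Lv L (j1 φ x) A ν :=
    hdL.clm_apply contDiff_const
  have hZA (A : Fin n) : ContDiff ℝ (⊤ : ℕ∞) fun x => Z x A := contDiff_pi.1 hZ A
  have hZAc (A : Fin n) : HasCompactSupport fun x => Z x A :=
    hZc.comp_left (g := fun y : Fin n → ℝ => y A) rfl
  have hint_y (A : Fin n) : Integrable fun x => Z x A * Ly L (j1 φ x) A :=
    ((hZA A).continuous.mul (hLy A)).integrable_of_hasCompactSupport (hZAc A).mul_right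
  have hint_v (A : Fin n) (ν : Fin m) :
      Integrable fun x => Lv L (j1 φ x) A ν * pd (fun x' => Z x' A) ν x :=
    ((hLv A ν).continuous.mul
      (contDiff_pd (hZA A) ν).continuous).integrable_of_hasCompactSupport
      ((hZAc A).fderiv_apply ℝ _).mul_left
  have hint_d (A : Fin n) (ν : Fin m) :
      Integrable fun x => Z x A * pd (fun x' => Lv L (j1 φ x') A ν) ν x :=
    ((hZA A).continuous.mul
      (contDiff_pd (hLv A ν) ν).continuous).integrable_of_hasCompactSupport (hZAc A).mul_right
  have hint_vs (A : Fin n) :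
      Integrable fun x => ∑ ν, Lv L (j1 φ x) A ν * pd (fun x' => Z x' A) ν x :=
    integrable_finsetSum _ fun ν _ => hint_v A ν
  have hint_ds (A : Fin n) :
      Integrable fun x => ∑ ν, Z x A * pd (fun x' => Lv L (j1 φ x') A ν) ν x :=
    integrable_finsetSum _ fun ν _ => hint_d A ν
  have key := hasDerivAt_integral_comp_add_smul (μ := (volume : Measure (Fin m → ℝ)))
    (hL.of_le (by simp)) hj.continuous
    (continuous_j1Vertical hZ) (hasCompactSupport_j1Vertical hZc)
  simp_rw [j1_add_smul hφd hZd]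
  convert key using 1
  simp_rw [j1Vertical, fderiv_apply_vertical, mul_sub, Finset.mul_sum]
  rw [integral_finsetSum _ fun A _ => by exact (hint_y A).sub (hint_ds A),
    integral_finsetSum _ fun A _ => by exact (hint_y A).add (hint_vs A)]
  refine Finset.sum_congr rfl fun A _ => ?_
  rw [integral_sub (hint_y A) (hint_ds A), integral_add (hint_y A) (hint_vs A),
    integral_finsetSum _ fun ν _ => hint_d A ν, integral_finsetSum _ fun ν _ => hint_v A ν,
    sub_eq_add_neg, ← Finset.sum_neg_distrib]
  congr 1
  refine Finset.sum_congr rfl fun ν _ => ?_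
  rw [integral_mul_pd_eq_neg (hLv A ν) (hZA A) (hZAc A) ν]
  simp_rw [mul_comm]
end

section
/- Equivalence theorem, Lagrangian to Hamiltonian direction (coordinate version of Theorem 3): Let L : J → ℝ be a smooth hyperregular Lagrangian with associated Hamiltonian h. If a smooth map φ : (Fin m → ℝ) → (Fin n → ℝ) satisfies the Euler–Lagrange equations for L, then the pair (y, p) with y = φ and p(x) = (fun A ν ↦ (∂L/∂v^A_ν)(j¹φ(x))) satisfies the Hamilton–De Donder–Weyl equations for h at every point. -/
open MeasureTheory

/-- The Legendre map associated with the Lagrangian `L`. -/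
noncomputable def FL {m n : ℕ} (L : (Fin m → ℝ) × (Fin n → ℝ) × (Fin n → Fin m → ℝ) → ℝ)
    (z : (Fin m → ℝ) × (Fin n → ℝ) × (Fin n → Fin m → ℝ)) :
    (Fin m → ℝ) × (Fin n → ℝ) × (Fin n → Fin m → ℝ) :=
  (z.1, z.2.1, fun A ν => Lv L z A ν)

/-- A linear functional on the jet space, restricted to the fibre directions, in coordinates. -/
lemma map_fibre_eq_sum {m n : ℕ}
    (T : ((Fin m → ℝ) × (Fin n → ℝ) × (Fin n → Fin m → ℝ)) →L[ℝ] ℝ) (v : Fin n → Fin m → ℝ) :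
    T (0, 0, v) = ∑ A : Fin n, ∑ ν : Fin m, v A ν * T (0, 0, Pi.single A (Pi.single ν 1)) := by
  let S : (Fin n → Fin m → ℝ) →ₗ[ℝ] ℝ :=
    T.toLinearMap ∘ₗ LinearMap.inr ℝ _ _ ∘ₗ LinearMap.inr ℝ _ _
  have hv : v = ∑ A : Fin n, ∑ ν : Fin m, v A ν • Pi.single A (Pi.single ν (1 : ℝ)) := by
    ext B μ
    simp [Finset.sum_apply, Pi.single_apply, apply_ite, ite_apply]
  calc T (0, 0, v) = S v := rfl
    _ = ∑ A : Fin n, ∑ ν : Fin m, v A ν * S (Pi.single A (Pi.single ν 1)) := by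
      conv_lhs => rw [hv]
      simp only [map_sum, map_smul, smul_eq_mul]

/-- The differential of the Hamiltonian at the image of `u` under the Legendre map. -/
lemma fderiv_hamiltonian_legendre {m n : ℕ}
    {L : (Fin m → ℝ) × (Fin n → ℝ) × (Fin n → Fin m → ℝ) → ℝ} (hL : Differentiable ℝ L)
    {FLinv : (Fin m → ℝ) × (Fin n → ℝ) × (Fin n → Fin m → ℝ) →
      (Fin m → ℝ) × (Fin n → ℝ) × (Fin n → Fin m → ℝ)}
    (hFLinv : Differentiable ℝ FLinv)
    (hleft : Function.LeftInverse FLinv (FL L))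
    {h : (Fin m → ℝ) × (Fin n → ℝ) × (Fin n → Fin m → ℝ) → ℝ}
    (hdef : ∀ z : (Fin m → ℝ) × (Fin n → ℝ) × (Fin n → Fin m → ℝ),
      h z = (∑ A : Fin n, ∑ ν : Fin m, z.2.2 A ν * (FLinv z).2.2 A ν)
        - L (z.1, z.2.1, (FLinv z).2.2))
    (u w : (Fin m → ℝ) × (Fin n → ℝ) × (Fin n → Fin m → ℝ)) :
    fderiv ℝ h (FL L u) w =
      (∑ A : Fin n, ∑ ν : Fin m, w.2.2 A ν * u.2.2 A ν) - fderiv ℝ L u (w.1, w.2.1, 0) := by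
  obtain rfl : h = _ := funext hdef
  have hinv := (hFLinv (FL L u)).hasFDerivAt
  set D := fderiv ℝ FLinv (FL L u)
  have hv := hinv.snd.snd
  have hvc (A : Fin n) (ν : Fin m) := hasFDerivAt_pi'.1 (hasFDerivAt_pi'.1 hv A) ν
  have hp := (hasFDerivAt_id (𝕜 := ℝ) (FL L u)).snd.snd
  have hpc (A : Fin n) (ν : Fin m) := hasFDerivAt_pi'.1 (hasFDerivAt_pi'.1 hp A) ν
  have hpair := HasFDerivAt.fun_sum (u := Finset.univ) fun A _ =>
    HasFDerivAt.fun_sum (u := Finset.univ) fun ν _ => (hpc A ν).mul (hvc A ν)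
  have hbase := (hasFDerivAt_id (𝕜 := ℝ) (FL L u)).fst.prodMk
    ((hasFDerivAt_id (𝕜 := ℝ) (FL L u)).snd.fst.prodMk hv)
  have hLd : HasFDerivAt L (fderiv ℝ L u)
      ((FL L u).1, (FL L u).2.1, (FLinv (FL L u)).2.2) := by
    rw [hleft u]
    exact (hL u).hasFDerivAt
  have key := (hpair.sub (hLd.comp (FL L u) hbase)).fderiv
  have happ := DFunLike.congr_fun key w
  have hsplit : fderiv ℝ L u (w.1, w.2.1, (D w).2.2) =
      fderiv ℝ L u (w.1, w.2.1, 0) + ∑ A : Fin n, ∑ ν : Fin m, (D w).2.2 A ν * Lv L u A ν := by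
    have := map_fibre_eq_sum (fderiv ℝ L u) (D w).2.2
    unfold Lv
    rw [← this, ← map_add]
    simp
  refine happ.trans ?_
  simp [hleft u, hsplit, Finset.sum_add_distrib]
  simp only [FL, mul_comm]
  ring

/-- Equivalence theorem, Lagrangian → Hamiltonian direction. -/
theorem euler_lagrange_implies_HDW
    (m n : ℕ) (hm : 0 < m) (hn : 0 < n)
    (L : (Fin m → ℝ) × (Fin n → ℝ) × (Fin n → Fin m → ℝ) → ℝ) (hL : ContDiff ℝ (⊤ : ℕ∞) L)
    -- hyperregularity: the Legendre map is a bijection with smooth inverse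
    (FLinv : (Fin m → ℝ) × (Fin n → ℝ) × (Fin n → Fin m → ℝ) →
      (Fin m → ℝ) × (Fin n → ℝ) × (Fin n → Fin m → ℝ))
    (hFLinv : ContDiff ℝ (⊤ : ℕ∞) FLinv)
    (hleft : Function.LeftInverse FLinv (FL L))
    (hright : Function.RightInverse FLinv (FL L))
    -- the associated Hamiltonian
    (h : (Fin m → ℝ) × (Fin n → ℝ) × (Fin n → Fin m → ℝ) → ℝ)
    (hdef : ∀ z : (Fin m → ℝ) × (Fin n → ℝ) × (Fin n → Fin m → ℝ),
      h z = (∑ A : Fin n, ∑ ν : Fin m, z.2.2 A ν * (FLinv z).2.2 A ν)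
        - L (z.1, z.2.1, (FLinv z).2.2))
    (φ : (Fin m → ℝ) → (Fin n → ℝ)) (hφ : ContDiff ℝ (⊤ : ℕ∞) φ)
    -- φ satisfies the Euler–Lagrange equations
    (hEL : ∀ (x : Fin m → ℝ) (A : Fin n),
      Ly L (j1 φ x) A - ∑ ν : Fin m, pd (fun x' => Lv L (j1 φ x') A ν) ν x = 0) :
    -- then (y, p) := (φ, ∂L/∂v ∘ j¹φ) satisfies the Hamilton–De Donder–Weyl equations
    (∀ (x : Fin m → ℝ) (A : Fin n) (ν : Fin m),
      pd (fun x' => φ x' A) ν x =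
        Lv h (x, φ x, fun B μ => Lv L (j1 φ x) B μ) A ν) ∧
    (∀ (x : Fin m → ℝ) (A : Fin n),
      ∑ ν : Fin m, pd (fun x' => Lv L (j1 φ x') A ν) ν x =
        - Ly h (x, φ x, fun B μ => Lv L (j1 φ x) B μ) A) := by
  have hd := fderiv_hamiltonian_legendre (hL.differentiable (by simp))
    (hFLinv.differentiable (by simp)) hleft hdef
  refine ⟨fun x A ν => ?_, fun x A => ?_⟩
  · have hx := hd (j1 φ x) (0, 0, Pi.single A (Pi.single ν 1))
    have h0 : fderiv ℝ L (j1 φ x) (0, 0, 0) = 0 := map_zero _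
    change _ = fderiv ℝ h (FL L (j1 φ x)) _
    rw [hx, h0]
    simp [Pi.single_apply, ite_apply, j1]
  · have hx := hd (j1 φ x) (0, Pi.single A 1, 0)
    change _ = -fderiv ℝ h (FL L (j1 φ x)) _
    rw [hx]
    have := hEL x A
    unfold Ly at this
    simp only [Pi.zero_apply, zero_mul, Finset.sum_const_zero]
    linarith
end

section
/- Equivalence theorem, Hamiltonian to Lagrangian direction (coordinate version of Theorem 3): Let L : J → ℝ be a smooth hyperregular Lagrangian with associated Hamiltonian h. If smooth maps y : (Fin m → ℝ) → (Fin n → ℝ) and p : (Fin m → ℝ) → (Fin n → Fin m → ℝ) satisfy the Hamilton–De Donder–Weyl equations for h, then φ = y satisfies the Euler–Lagrange equations for L, and moreover p(x) = (fun A ν ↦ (∂L/∂v^A_ν)(j¹y(x))) for every x. -/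
open MeasureTheory

/-- The derivative of `L` in a fibre direction, in terms of the partial derivatives `Lv`. -/
theorem fderiv_fibre_eq_sum {m n : ℕ} (L : (Fin m → ℝ) × (Fin n → ℝ) × (Fin n → Fin m → ℝ) → ℝ)
    (z : (Fin m → ℝ) × (Fin n → ℝ) × (Fin n → Fin m → ℝ)) (u : Fin n → Fin m → ℝ) :
    fderiv ℝ L z (0, 0, u) = ∑ A, ∑ ν, Lv L z A ν * u A ν := by
  have hu : ((0, 0, u) : (Fin m → ℝ) × (Fin n → ℝ) × (Fin n → Fin m → ℝ)) =
      ∑ A, ∑ ν, u A ν • (0, 0, Pi.single A (Pi.single ν 1)) := by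
    refine Prod.ext ?_ (Prod.ext ?_ ?_)
    · simp [Prod.fst_sum]
    · simp [Prod.fst_sum, Prod.snd_sum]
    · ext B μ
      simp [Prod.snd_sum, Finset.sum_apply, Pi.single_apply, ite_apply]
  rw [hu]
  simp only [map_sum, map_smul, smul_eq_mul, Lv, mul_comm]

/-- The envelope identity for the Legendre transform: the terms containing the derivative of the
inverse Legendre map `G` cancel in the derivative of the Hamiltonian. -/
theorem fderiv_hamiltonian {m n : ℕ}
    {L h : (Fin m → ℝ) × (Fin n → ℝ) × (Fin n → Fin m → ℝ) → ℝ} (hL : Differentiable ℝ L)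
    {G : (Fin m → ℝ) × (Fin n → ℝ) × (Fin n → Fin m → ℝ) →
      (Fin m → ℝ) × (Fin n → ℝ) × (Fin n → Fin m → ℝ)}
    (hG : Differentiable ℝ G) (hright : Function.RightInverse G (FL L))
    (hdef : ∀ z, h z = (∑ A, ∑ ν, z.2.2 A ν * (G z).2.2 A ν) - L (z.1, z.2.1, (G z).2.2))
    (z d : (Fin m → ℝ) × (Fin n → ℝ) × (Fin n → Fin m → ℝ)) :
    fderiv ℝ h z d =
      (∑ A, ∑ ν, d.2.2 A ν * (G z).2.2 A ν) - fderiv ℝ L (G z) (d.1, d.2.1, 0) := by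
  have hz : (z.1, z.2.1, (G z).2.2) = G z :=
    Prod.ext (congrArg (fun w => w.1) (hright z)).symm
      (Prod.ext (congrArg (fun w => w.2.1) (hright z)).symm rfl)
  have hLv (A : Fin n) (ν : Fin m) : Lv L (G z) A ν = z.2.2 A ν :=
    congrArg (fun w => w.2.2 A ν) (hright z)
  have hV : HasFDerivAt (fun w => (G w).2.2) _ z := (hG z).hasFDerivAt.snd.snd
  have hc (A : Fin n) (ν : Fin m) := hasFDerivAt_pi'.1 (hasFDerivAt_pi'.1 hV A) ν
  have hP : HasFDerivAt 
      (fun w : (Fin m → ℝ) × (Fin n → ℝ) × (Fin n → Fin m → ℝ) => w.2.2) _ z :=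
    (hasFDerivAt_snd (𝕜 := ℝ) (p := z)).snd
  have hpc (A : Fin n) (ν : Fin m) := hasFDerivAt_pi'.1 (hasFDerivAt_pi'.1 hP A) ν
  have hsum := HasFDerivAt.fun_sum (u := Finset.univ) fun (A : Fin n) _ =>
    HasFDerivAt.fun_sum (u := Finset.univ) fun (ν : Fin m) _ => (hpc A ν).mul (hc A ν)
  have hLz : HasFDerivAt L (fderiv ℝ L (G z)) (z.1, z.2.1, (G z).2.2) := by
    rw [hz]; exact (hL _).hasFDerivAt
  have hjet := (hasFDerivAt_fst (𝕜 := ℝ) (p := z)).prodMk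
    ((hasFDerivAt_snd (𝕜 := ℝ) (p := z)).fst.prodMk hV)
  have hcomp := HasFDerivAt.comp z (g := L) hLz hjet
  have hh := (hsum.sub hcomp).congr_of_eventuallyEq (f₁ := h) (.of_forall fun w => by
    simp [hdef])
  have hsplit (u : Fin n → Fin m → ℝ) : fderiv ℝ L (G z) (d.1, d.2.1, u) =
      fderiv ℝ L (G z) (d.1, d.2.1, 0) + ∑ A, ∑ ν, z.2.2 A ν * u A ν := by
    simp only [← hLv]
    rw [← fderiv_fibre_eq_sum, ← map_add]
    simp
  rw [hh.fderiv]
  simp [hsplit (fderiv ℝ G z d).2.2, Finset.sum_add_distrib]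
  simp only [mul_comm (d.2.2 _ _)]
  ring

/-- Equivalence theorem, Hamiltonian → Lagrangian direction. -/
theorem HDW_implies_euler_lagrange
    (m n : ℕ) (hm : 0 < m) (hn : 0 < n)
    (L : (Fin m → ℝ) × (Fin n → ℝ) × (Fin n → Fin m → ℝ) → ℝ) (hL : ContDiff ℝ (⊤ : ℕ∞) L)
    -- hyperregularity: the Legendre map is a bijection with smooth inverse
    (FLinv : (Fin m → ℝ) × (Fin n → ℝ) × (Fin n → Fin m → ℝ) →
      (Fin m → ℝ) × (Fin n → ℝ) × (Fin n → Fin m → ℝ))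
    (hFLinv : ContDiff ℝ (⊤ : ℕ∞) FLinv)
    (hleft : Function.LeftInverse FLinv (FL L))
    (hright : Function.RightInverse FLinv (FL L))
    -- the associated Hamiltonian
    (h : (Fin m → ℝ) × (Fin n → ℝ) × (Fin n → Fin m → ℝ) → ℝ)
    (hdef : ∀ z : (Fin m → ℝ) × (Fin n → ℝ) × (Fin n → Fin m → ℝ),
      h z = (∑ A : Fin n, ∑ ν : Fin m, z.2.2 A ν * (FLinv z).2.2 A ν)
        - L (z.1, z.2.1, (FLinv z).2.2))
    (y : (Fin m → ℝ) → (Fin n → ℝ)) (hy : ContDiff ℝ (⊤ : ℕ∞) y)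
    (p : (Fin m → ℝ) → (Fin n → Fin m → ℝ)) (hp : ContDiff ℝ (⊤ : ℕ∞) p)
    -- (y, p) satisfies the Hamilton–De Donder–Weyl equations
    (hHDW1 : ∀ (x : Fin m → ℝ) (A : Fin n) (ν : Fin m),
      pd (fun x' => y x' A) ν x = Lv h (x, y x, p x) A ν)
    (hHDW2 : ∀ (x : Fin m → ℝ) (A : Fin n),
      ∑ ν : Fin m, pd (fun x' => p x' A ν) ν x = - Ly h (x, y x, p x) A) :
    -- then y satisfies the Euler–Lagrange equations and p is given by the Legendre map
    (∀ (x : Fin m → ℝ) (A : Fin n),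
      Ly L (j1 y x) A - ∑ ν : Fin m, pd (fun x' => Lv L (j1 y x') A ν) ν x = 0) ∧
    (∀ x : Fin m → ℝ, p x = fun A ν => Lv L (j1 y x) A ν) := by
  have hL' : Differentiable ℝ L := hL.differentiable (by simp)
  have hG' : Differentiable ℝ FLinv := hFLinv.differentiable (by simp)
  have hD := fderiv_hamiltonian hL' hG' hright hdef
  have hj (x : Fin m → ℝ) : j1 y x = FLinv (x, y x, p x) := by
    have hr := hright (x, y x, p x)
    refine Prod.ext (congrArg (fun w => w.1) hr).symm
      (Prod.ext (congrArg (fun w => w.2.1) hr).symm ?_)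
    ext A ν
    simp [j1, hHDW1, Lv, hD, Pi.single_apply, ite_apply, ite_mul]
    exact map_zero _
  have hpL (x : Fin m → ℝ) : p x = fun A ν => Lv L (j1 y x) A ν := by
    rw [hj]
    exact (congrArg (fun w => w.2.2) (hright (x, y x, p x))).symm
  refine ⟨fun x A => ?_, hpL⟩
  have hLv (ν : Fin m) : (fun x' => Lv L (j1 y x') A ν) = fun x' => p x' A ν := by
    ext x'
    rw [hpL]
  simp only [hLv, hHDW2]
  simp [Ly, hD, hj]
end

section
/- Holonomy arises naturally in the unified formalism (coordinate version of part of Theorem 4): Let L : J → ℝ be smooth. If (y, v, p) is a critical unified section, then v^A_ν(x) = ∂y^A/∂x^ν(x) for every x, A, ν. -/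
open MeasureTheory

/-- The unified (Lagrange–Hamilton) action density. -/
noncomputable def U {m n : ℕ} (L : (Fin m → ℝ) × (Fin n → ℝ) × (Fin n → Fin m → ℝ) → ℝ)
    (y : (Fin m → ℝ) → (Fin n → ℝ)) (v p : (Fin m → ℝ) → (Fin n → Fin m → ℝ))
    (x : Fin m → ℝ) : ℝ :=
  L (x, y x, v x) +
    ∑ A : Fin n, ∑ ν : Fin m, p x A ν * (pd (fun x' => y x' A) ν x - v x A ν)

/-- `(y, v, p)` is a critical section of the unified action. -/
noncomputable def CriticalUnified {m n : ℕ}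
    (L : (Fin m → ℝ) × (Fin n → ℝ) × (Fin n → Fin m → ℝ) → ℝ)
    (y : (Fin m → ℝ) → (Fin n → ℝ)) (v p : (Fin m → ℝ) → (Fin n → Fin m → ℝ)) : Prop :=
  ∀ (Z : (Fin m → ℝ) → (Fin n → ℝ)) (V W : (Fin m → ℝ) → (Fin n → Fin m → ℝ)),
    ContDiff ℝ (⊤ : ℕ∞) Z → HasCompactSupport Z → ContDiff ℝ (⊤ : ℕ∞) V → HasCompactSupport V →
    ContDiff ℝ (⊤ : ℕ∞) W → HasCompactSupport W →
    HasDerivAt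
      (fun t : ℝ => ∫ x : Fin m → ℝ,
        (U L (y + t • Z) (v + t • V) (p + t • W) x - U L y v p x)) 0 0

/-- Varying only the momenta in one component changes the unified density linearly. -/
lemma U_add_smul_single_sub {m n : ℕ}
    (L : (Fin m → ℝ) × (Fin n → ℝ) × (Fin n → Fin m → ℝ) → ℝ)
    (y : (Fin m → ℝ) → (Fin n → ℝ)) (v p : (Fin m → ℝ) → (Fin n → Fin m → ℝ))
    (g : (Fin m → ℝ) → ℝ) (A : Fin n) (ν : Fin m) (t : ℝ) (x : Fin m → ℝ) :
    U L y v (p + t • fun x => g x • (Pi.single A (Pi.single ν 1) : Fin n → Fin m → ℝ)) x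
        - U L y v p x
      = t * (g x * (pd (fun x' => y x' A) ν x - v x A ν)) := by
  have hs : ∀ (B : Fin n) (μ : Fin m),
      (Pi.single A (Pi.single ν 1) : Fin n → Fin m → ℝ) B μ
        = if B = A then (if μ = ν then 1 else 0) else 0 := by
    intro B μ
    by_cases hB : B = A
    · subst hB
      simp [Pi.single_apply]
    · simp [hB]
  simp only [U, add_sub_add_left_eq_sub, ← Finset.sum_sub_distrib, Pi.add_apply, Pi.smul_apply,
    smul_eq_mul, hs, ← sub_mul, add_sub_cancel_left]
  rw [Finset.sum_eq_single A (fun B _ hB => by simp [hB]) (by simp),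
    Finset.sum_eq_single ν (fun μ _ hμ => by simp [hμ]) (by simp)]
  simp [mul_assoc]

/-- The coordinate partial derivatives of a smooth function are continuous. -/
lemma ContDiff.continuous_pd {m : ℕ} {f : (Fin m → ℝ) → ℝ} (hf : ContDiff ℝ (⊤ : ℕ∞) f)
    (ν : Fin m) : Continuous (pd f ν) :=
  (hf.continuous_fderiv (by simp)).clm_apply continuous_const

/-- Holonomy arises naturally in the unified formalism. -/
theorem holonomy_of_critical_unified_section
    (m n : ℕ) (hm : 0 < m) (hn : 0 < n)
    (L : (Fin m → ℝ) × (Fin n → ℝ) × (Fin n → Fin m → ℝ) → ℝ) (hL : ContDiff ℝ (⊤ : ℕ∞) L)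
    (y : (Fin m → ℝ) → (Fin n → ℝ)) (hy : ContDiff ℝ (⊤ : ℕ∞) y)
    (v : (Fin m → ℝ) → (Fin n → Fin m → ℝ)) (hv : ContDiff ℝ (⊤ : ℕ∞) v)
    (p : (Fin m → ℝ) → (Fin n → Fin m → ℝ)) (hp : ContDiff ℝ (⊤ : ℕ∞) p)
    (hcrit : CriticalUnified L y v p) :
    ∀ (x : Fin m → ℝ) (A : Fin n) (ν : Fin m), v x A ν = pd (fun x' => y x' A) ν x := by
  intro x A ν
  have hcont : Continuous fun x => pd (fun x' => y x' A) ν x - v x A ν :=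
    (ContDiff.continuous_pd (contDiff_pi.1 hy A) ν).sub
      (continuous_apply_apply A ν |>.comp hv.continuous)
  have hae : ∀ᵐ x, pd (fun x' => y x' A) ν x - v x A ν = 0 := by
    refine ae_eq_zero_of_integral_contDiff_smul_eq_zero hcont.locallyIntegrable ?_
    intro g hg hgs
    have h := hcrit 0 0 (fun x => g x • (Pi.single A (Pi.single ν 1) : Fin n → Fin m → ℝ))
      contDiff_const HasCompactSupport.zero contDiff_const HasCompactSupport.zero
      (hg.smul contDiff_const) hgs.smul_right
    simp only [smul_zero, add_zero, U_add_smul_single_sub, integral_const_mul] at h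
    simpa using ((hasDerivAt_id (0 : ℝ)).mul_const _).unique h
  have hzero := congrFun ((hcont.ae_eq_iff_eq volume continuous_const).1 hae) x
  exact (sub_eq_zero.1 hzero).symm
end

section
/- Regularity of a Lagrangian is equivalent to regularity of its Legendre map (coordinate content of the claim that the two definitions of regularity agree): Let L : J → ℝ be smooth and let FL : J → J be its Legendre map, FL(x, y, v) = (x, y, fun A ν ↦ (∂L/∂v^A_ν)(x, y, v)). Fix a point z₀ = (x₀, y₀, v₀) ∈ J and let g : (Fin n → Fin m → ℝ) → (Fin n → Fin m → ℝ) be the fiber map g(v) = (fun A ν ↦ (∂L/∂v^A_ν)(x₀, y₀, v)). Then the Fréchet derivative of FL at z₀ is a bijective (continuous) linear map if and only if the Fréchet derivative of g at v₀ is a bijective (continuous) linear map (i.e., if and only if the vertical Hessian ∂²L/∂v^B_μ∂v^A_ν at z₀ is invertible). -/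
/-- For `T` additive on `E × F × G`, the map `(a, b, c) ↦ (a, b, T (a, b, c))` is bijective if and
only if the restriction of `T` to the third factor is bijective. -/
theorem bijective_prodMk_iff_bijective_fiber {E F G H : Type*} [AddCommGroup E] [AddCommGroup F]
    [AddCommGroup G] [AddCommGroup H] (T : E × F × G →+ H) :
    Function.Bijective (fun z : E × F × G => (z.1, z.2.1, T z)) ↔
      Function.Bijective (fun w : G => T (0, 0, w)) := by
  have split (a : E) (b : F) (c : G) : T (a, b, c) = T (a, b, 0) + T (0, 0, c) := by
    rw [← map_add]; simp
  constructor
  · rintro ⟨hi, hs⟩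
    refine ⟨fun c c' h => ?_, fun d => ?_⟩
    · have := @hi (0, 0, c) (0, 0, c') (by simpa using h)
      simpa using this
    · obtain ⟨⟨a, b, c⟩, h⟩ := hs (0, 0, d)
      simp only [Prod.mk.injEq] at h
      obtain ⟨rfl, rfl, h⟩ := h
      exact ⟨c, h⟩
  · rintro ⟨hi, hs⟩
    refine ⟨?_, ?_⟩
    · rintro ⟨a, b, c⟩ ⟨a', b', c'⟩ h
      simp only [Prod.mk.injEq] at h
      obtain ⟨rfl, rfl, h⟩ := h
      rw [split a b c, split a b c'] at h
      rw [hi (add_left_cancel h)]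
    · rintro ⟨a, b, d⟩
      obtain ⟨c, hc⟩ := hs (d - T (a, b, 0))
      refine ⟨(a, b, c), ?_⟩
      simp only at hc
      simp only [split a b c, hc, add_sub_cancel]

theorem differentiable_Lv {m n : ℕ} {L : (Fin m → ℝ) × (Fin n → ℝ) × (Fin n → Fin m → ℝ) → ℝ}
    (hL : ContDiff ℝ 2 L) : Differentiable ℝ (Lv L) := by
  have h : Differentiable ℝ (fderiv ℝ L) :=
    (hL.fderiv_right (m := 1) (by norm_num)).differentiable (by norm_num)
  refine differentiable_pi.2 fun A => differentiable_pi.2 fun ν => ?_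
  exact h.clm_apply (differentiable_const _)

/-- Regularity of a Lagrangian is equivalent to regularity of its Legendre map. -/
theorem legendre_regular_iff_fiber_regular
    (m n : ℕ) (hm : 0 < m) (hn : 0 < n)
    (L : (Fin m → ℝ) × (Fin n → ℝ) × (Fin n → Fin m → ℝ) → ℝ) (hL : ContDiff ℝ (⊤ : ℕ∞) L)
    (x₀ : Fin m → ℝ) (y₀ : Fin n → ℝ) (v₀ : Fin n → Fin m → ℝ) :
    Function.Bijective (fderiv ℝ (FL L) (x₀, y₀, v₀)) ↔
      Function.Bijective (fderiv ℝ
        (fun v : Fin n → Fin m → ℝ =>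
          (fun A ν => Lv L (x₀, y₀, v) A ν : Fin n → Fin m → ℝ)) v₀) := by
  have hLv : HasFDerivAt (Lv L) (fderiv ℝ (Lv L) (x₀, y₀, v₀)) (x₀, y₀, v₀) :=
    (differentiable_Lv (contDiff_infty.1 hL 2) _).hasFDerivAt
  have hFL : HasFDerivAt (FL L) _ (x₀, y₀, v₀) :=
    hasFDerivAt_fst.prodMk (hasFDerivAt_snd.fst.prodMk hLv)
  have hincl : HasFDerivAt (fun v : Fin n → Fin m → ℝ => (x₀, y₀, v))
      (.inr ℝ (Fin m → ℝ) _ ∘L .inr ℝ (Fin n → ℝ) (Fin n → Fin m → ℝ)) v₀ :=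
    (hasFDerivAt_prodMk_right x₀ (y₀, v₀)).comp v₀ (hasFDerivAt_prodMk_right y₀ v₀)
  change _ ↔ Function.Bijective
    (fderiv ℝ (Lv L ∘ fun v : Fin n → Fin m → ℝ => (x₀, y₀, v)) v₀)
  rw [hFL.fderiv, (HasFDerivAt.comp (g := Lv L) v₀ hLv hincl).fderiv]
  exact bijective_prodMk_iff_bijective_fiber
    (fderiv ℝ (Lv L) (x₀, y₀, v₀)).toLinearMap.toAddMonoidHom
end
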